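/- Let 𝒜 be of nonstandard p(·)-growth with constants a₋, b⁺ and assume p⁻ > n. Let f : [0,∞) → ℝ be continuous and suppose there are a measurable variable exponent q : ℝⁿ → ℝ with q(x) ≥ 1, and measurable functions c, d : ℝⁿ → ℝ with c₋ ≤ c(x) ≤ c⁺ and d₋ ≤ d(x) ≤ d⁺ for constants 0 < c₋ and c⁺ < d₋, such that c(x) s^{q(x)} ≤ f(s) ≤ d(x)(1 + s^{p(x)−1}) for all x ∈ ℝⁿ and all s ≥ 0. If u is a bounded C¹ function on ℝⁿ with x ↦ |∇u(x)|^{p(x)} locally integrable satisfying the Riccati-type inequality −∫_{ℝⁿ} ⟨𝒜(x,u(x),∇u(x)), ∇φ(x)⟩ dx ≥ ∫_{ℝⁿ} f(|∇u(x)|) φ(x) dx for every nonnegative smooth compactly supported φ : ℝⁿ → ℝ, then u is constant. -/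

import Mathlib

open MeasureTheory Metric Real
open scoped ContDiff

noncomputable section

abbrev Euc (n : ℕ) := EuclideanSpace ℝ (Fin n)

/-- Measure of the unit ball in `ℝⁿ`. -/
def omegaEuc (n : ℕ) : ℝ := (volume (Metric.ball (0 : Euc n) 1)).toReal

/-- A measurable variable exponent `p` with `p⁻ = pm` and `p⁺ = pP`,
`1 < p⁻` and `p⁺ < ∞` (encoded by the a.e. bounds). -/
structure IsVarExp {n : ℕ} (p : Euc n → ℝ) (pm pP : ℝ) : Prop where
  meas : Measurable p
  one_lt : 1 < pm
  inf_eq : essInf p (volume : Measure (Euc n)) = pm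
  sup_eq : essSup p (volume : Measure (Euc n)) = pP
  ae_lb : ∀ᵐ x ∂(volume : Measure (Euc n)), pm ≤ p x
  ae_ub : ∀ᵐ x ∂(volume : Measure (Euc n)), p x ≤ pP

/-- `𝒜` is of nonstandard `p(·)`-growth with constants `am = a₋`, `bP = b⁺`. -/
structure IsNSGrowth {n : ℕ} (p : Euc n → ℝ) (𝒜 : Euc n → ℝ → Euc n → Euc n)
    (am bP : ℝ) : Prop where
  am_pos : 0 < am
  meas : ∀ (t : ℝ) (ξ : Euc n), Measurable (fun x => 𝒜 x t ξ)
  cont : ∀ x : Euc n, Continuous (fun tξ : ℝ × Euc n => 𝒜 x tξ.1 tξ.2)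
  growth : ∃ a b : Euc n → ℝ, Measurable a ∧ Measurable b ∧
      (∀ x, am ≤ a x ∧ a x ≤ b x ∧ b x ≤ bP) ∧
      (∀ x t ξ, a x * ‖ξ‖ ^ p x ≤ (inner ℝ (𝒜 x t ξ) ξ : ℝ)) ∧
      (∀ x t ξ, ‖𝒜 x t ξ‖ ≤ b x * ‖ξ‖ ^ (p x - 1))

/-- `u` is `𝒜`-harmonic in `ℝⁿ` (C¹ functions replace `W^{1,p(·)}_loc`). -/
def IsAHarmonic {n : ℕ} (p : Euc n → ℝ) (𝒜 : Euc n → ℝ → Euc n → Euc n)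
    (u : Euc n → ℝ) : Prop :=
  ContDiff ℝ 1 u ∧
  LocallyIntegrable (fun x => ‖gradient u x‖ ^ p x) (volume : Measure (Euc n)) ∧
  ∀ φ : Euc n → ℝ, ContDiff ℝ ∞ φ → HasCompactSupport φ →
    ∫ x, (inner ℝ (𝒜 x (u x) (gradient u x)) (gradient φ x) : ℝ) = 0

/-- `u` is an `𝒜`-subsolution in `ℝⁿ`. -/
def IsASubsolution {n : ℕ} (p : Euc n → ℝ) (𝒜 : Euc n → ℝ → Euc n → Euc n)
    (u : Euc n → ℝ) : Prop :=
  ContDiff ℝ 1 u ∧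
  LocallyIntegrable (fun x => ‖gradient u x‖ ^ p x) (volume : Measure (Euc n)) ∧
  ∀ φ : Euc n → ℝ, ContDiff ℝ ∞ φ → HasCompactSupport φ → (∀ x, 0 ≤ φ x) →
    ∫ x, (inner ℝ (𝒜 x (u x) (gradient u x)) (gradient φ x) : ℝ) ≤ 0

/-- `ℬ` is an admissible right-hand side. -/
structure IsAdmissibleRHS {n : ℕ} (p : Euc n → ℝ) (ℬ : Euc n → ℝ → Euc n → ℝ) : Prop where
  meas : ∀ (t : ℝ) (ξ : Euc n), Measurable (fun x => ℬ x t ξ)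
  cont : ∀ x : Euc n, Continuous (fun tξ : ℝ × Euc n => ℬ x tξ.1 tξ.2)
  bound : ∃ c : Euc n → ℝ, Measurable c ∧ (∃ cP : ℝ, ∀ x, c x ≤ cP) ∧
      ∀ x t ξ, |ℬ x t ξ| ≤ c x * (1 + ‖ξ‖ ^ (p x - 1))

/-- `u` is `(𝒜,ℬ)`-harmonic in `ℝⁿ`. -/
def IsABHarmonic {n : ℕ} (p : Euc n → ℝ) (𝒜 : Euc n → ℝ → Euc n → Euc n)
    (ℬ : Euc n → ℝ → Euc n → ℝ) (u : Euc n → ℝ) : Prop :=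
  ContDiff ℝ 1 u ∧
  LocallyIntegrable (fun x => ‖gradient u x‖ ^ p x) (volume : Measure (Euc n)) ∧
  ∀ φ : Euc n → ℝ, ContDiff ℝ ∞ φ → HasCompactSupport φ →
    ∫ x, (inner ℝ (𝒜 x (u x) (gradient u x)) (gradient φ x) : ℝ)
      = ∫ x, ℬ x (u x) (gradient u x) * φ x

/-- `u` is a supersolution of `div 𝒜(x,u,∇u) = f(u)` in `ℝⁿ`. -/
def IsFSupersolution {n : ℕ} (p : Euc n → ℝ) (𝒜 : Euc n → ℝ → Euc n → Euc n)
    (f : ℝ → ℝ) (u : Euc n → ℝ) : Prop :=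
  ContDiff ℝ 1 u ∧
  LocallyIntegrable (fun x => ‖gradient u x‖ ^ p x) (volume : Measure (Euc n)) ∧
  ∀ φ : Euc n → ℝ, ContDiff ℝ ∞ φ → HasCompactSupport φ → (∀ x, 0 ≤ φ x) →
    ∫ x, f (u x) * φ x ≤ - ∫ x, (inner ℝ (𝒜 x (u x) (gradient u x)) (gradient φ x) : ℝ)


/-- A nonnegative compactly supported `C¹` function is approximated, uniformly together with its
derivative, by nonnegative smooth functions supported in a fixed ball. -/
theorem exists_contDiff_fderiv_approx {n : ℕ} {φ : Euc n → ℝ} (hφ : ContDiff ℝ 1 φ) {R : ℝ}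
    (hsupp : Function.support φ ⊆ closedBall 0 R) (hnn : ∀ x, 0 ≤ φ x) {ε : ℝ} (hε : 0 < ε) :
    ∃ ψ : Euc n → ℝ, ContDiff ℝ ∞ ψ ∧ tsupport ψ ⊆ closedBall 0 (R + 1) ∧ (∀ x, 0 ≤ ψ x) ∧
      ∀ x, ‖fderiv ℝ ψ x - fderiv ℝ φ x‖ ≤ ε := by
  have hcs : HasCompactSupport φ :=
    HasCompactSupport.of_support_subset_isCompact (isCompact_closedBall 0 R) hsupp
  have huc : UniformContinuous (fderiv ℝ φ) :=
    (hcs.fderiv ℝ).uniformContinuous_of_continuous (hφ.continuous_fderiv one_ne_zero)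
  obtain ⟨δ, hδ, hδε⟩ := Metric.uniformContinuous_iff.1 huc ε hε
  have hr : 0 < min δ 1 := lt_min hδ one_pos
  let b : ContDiffBump (0 : Euc n) := ⟨min δ 1 / 2, min δ 1, half_pos hr, half_lt_self hr⟩
  let L := ContinuousLinearMap.lsmul ℝ ℝ (E := ℝ)
  have hloc : LocallyIntegrable (b.normed volume) (volume : Measure (Euc n)) :=
    b.continuous_normed.locallyIntegrable
  refine ⟨convolution (b.normed volume) φ L volume,
    b.hasCompactSupport_normed.contDiff_convolution_left L b.contDiff_normed
      hφ.continuous.locallyIntegrable, ?_, fun x => ?_, fun x => ?_⟩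
  · refine closure_minimal ?_ isClosed_closedBall
    refine (support_convolution_subset L).trans ?_
    rintro _ ⟨y, hy, z, hz, rfl⟩
    rw [b.support_normed_eq, mem_ball_zero_iff] at hy
    have hz' := hsupp hz
    rw [mem_closedBall_zero_iff] at hz' ⊢
    have : ‖y‖ ≤ 1 := hy.le.trans (min_le_right _ _)
    exact (norm_add_le y z).trans (by linarith)
  · exact integral_nonneg fun t => mul_nonneg (b.nonneg_normed t) (hnn _)
  · rw [(hcs.hasFDerivAt_convolution_right L hloc hφ x).fderiv, ← dist_eq_norm]
    have hL : L.precompR (Euc n) = ContinuousLinearMap.lsmul ℝ ℝ := by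
      ext; rfl
    rw [hL]
    refine b.dist_normed_convolution_le
      (hφ.continuous_fderiv one_ne_zero).aestronglyMeasurable fun y hy => (hδε ?_).le
    exact (mem_ball.1 hy).trans_le (min_le_left _ _)

theorem norm_gradient_eq_norm_fderiv {n : ℕ} (φ : Euc n → ℝ) (x : Euc n) :
    ‖gradient φ x‖ = ‖fderiv ℝ φ x‖ :=
  LinearIsometryEquiv.norm_map _ _

theorem ContDiff.continuous_gradient {n : ℕ} {φ : Euc n → ℝ} (hφ : ContDiff ℝ 1 φ) :
    Continuous (gradient φ) :=
  (LinearIsometryEquiv.continuous _).comp (hφ.continuous_fderiv one_ne_zero)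

theorem gradient_eq_zero_of_notMem_tsupport {n : ℕ} {φ : Euc n → ℝ} {x : Euc n}
    (hx : x ∉ tsupport φ) : gradient φ x = 0 := by
  rw [← norm_eq_zero, norm_gradient_eq_norm_fderiv, fderiv_of_notMem_tsupport ℝ hx, norm_zero]

theorem inner_gradient_eq_fderiv {n : ℕ} (φ : Euc n → ℝ) (x v : Euc n) :
    (inner ℝ v (gradient φ x) : ℝ) = fderiv ℝ φ x v := by
  simp [inner_gradient_right]

theorem integrable_inner_gradient {n : ℕ} {F : Euc n → Euc n} (hF : LocallyIntegrable F volume)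
    {φ : Euc n → ℝ} (hφ : ContDiff ℝ 1 φ) (hc : HasCompactSupport φ) :
    Integrable (fun x => (inner ℝ (F x) (gradient φ x) : ℝ)) volume := by
  have hcont := hφ.continuous_gradient
  obtain ⟨C, hC⟩ := (hc.fderiv ℝ).exists_bound_of_continuous (hφ.continuous_fderiv one_ne_zero)
  have hint : IntegrableOn F (tsupport φ) volume := hF.integrableOn_isCompact hc
  have : IntegrableOn (fun x => (inner ℝ (F x) (gradient φ x) : ℝ)) (tsupport φ) volume := by
    refine (hint.norm.mul_const C).mono
      (hint.aestronglyMeasurable.inner hcont.aestronglyMeasurable) (.of_forall fun x => ?_)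
    refine (norm_inner_le_norm _ _).trans ?_
    rw [norm_gradient_eq_norm_fderiv]
    exact (mul_le_mul_of_nonneg_left (hC x) (norm_nonneg _)).trans (le_abs_self _)
  refine (integrableOn_iff_integrable_of_support_subset fun x hx => ?_).1 this
  by_contra h
  exact hx (by simp [gradient_eq_zero_of_notMem_tsupport h])

/-- A distributional inequality tested against smooth functions extends to `C¹` functions. -/
theorem integral_inner_gradient_nonpos_of_contDiff_one {n : ℕ} {F : Euc n → Euc n}
    (hF : LocallyIntegrable F volume)
    (hsub : ∀ φ : Euc n → ℝ, ContDiff ℝ ∞ φ → HasCompactSupport φ → (∀ x, 0 ≤ φ x) →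
      ∫ x, (inner ℝ (F x) (gradient φ x) : ℝ) ≤ 0)
    {φ : Euc n → ℝ} (hφ : ContDiff ℝ 1 φ) (hc : HasCompactSupport φ) (hnn : ∀ x, 0 ≤ φ x) :
    ∫ x, (inner ℝ (F x) (gradient φ x) : ℝ) ≤ 0 := by
  obtain ⟨R, hR⟩ := hc.isBounded.subset_closedBall (0 : Euc n)
  set K : Set (Euc n) := closedBall 0 (R + 1)
  have hFK : IntegrableOn F K volume := hF.integrableOn_isCompact (isCompact_closedBall _ _)
  set I := ∫ x in K, ‖F x‖
  have hI : 0 ≤ I := integral_nonneg fun x => norm_nonneg _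
  refine le_of_forall_pos_le_add fun ε hε => ?_
  have hε' : 0 < ε / (I + 1) := by positivity
  obtain ⟨ψ, hψ, hψK, hψ0, hψφ⟩ :=
    exists_contDiff_fderiv_approx hφ ((subset_tsupport φ).trans hR) hnn hε'
  have hψc : HasCompactSupport ψ :=
    (isCompact_closedBall _ _).of_isClosed_subset (isClosed_tsupport ψ) hψK
  have hφK : tsupport φ ⊆ K := hR.trans (closedBall_subset_closedBall (by linarith))
  have h1 := integrable_inner_gradient hF hφ hc
  have h2 := integrable_inner_gradient hF (hψ.of_le (by simp)) hψc
  have h3 : Integrable (K.indicator fun x => ‖F x‖ * (ε / (I + 1))) volume :=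
    (integrable_indicator_iff measurableSet_closedBall).2 (hFK.norm.mul_const _)
  have hle : ∫ x, (inner ℝ (F x) (gradient φ x) : ℝ) ≤
      ∫ x, ((inner ℝ (F x) (gradient ψ x) : ℝ) +
        K.indicator (fun x => ‖F x‖ * (ε / (I + 1))) x) := by
    refine integral_mono h1 (h2.add h3) fun x => ?_
    by_cases hx : x ∈ K
    · simp only [Set.indicator_of_mem hx, inner_gradient_eq_fderiv]
      have : fderiv ℝ φ x (F x) - fderiv ℝ ψ x (F x) ≤ ‖F x‖ * (ε / (I + 1)) := by
        rw [← sub_apply, mul_comm]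
        refine (le_abs_self _).trans (((fderiv ℝ φ x - fderiv ℝ ψ x).le_opNorm _).trans ?_)
        rw [norm_sub_rev]
        exact mul_le_mul_of_nonneg_right (hψφ x) (norm_nonneg _)
      linarith
    · simp [Set.indicator_of_notMem hx,
        gradient_eq_zero_of_notMem_tsupport fun h => hx (hφK h),
        gradient_eq_zero_of_notMem_tsupport fun h => hx (hψK h)]
  rw [integral_add h2 h3, integral_indicator measurableSet_closedBall, integral_mul_const] at hle
  have h4 : I * (ε / (I + 1)) ≤ ε := by
    rw [mul_div_assoc', div_le_iff₀ (by positivity)]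
    nlinarith
  linarith [hsub ψ hψ hψc hψ0]

/-- Absorption inequality replacing Young's inequality for a variable exponent. -/
theorem mul_rpow_sub_one_mul_le {α K e s t r P : ℝ} {k : ℕ} (hα : 0 < α) (hK : 0 ≤ K)
    (he0 : 0 ≤ e) (he1 : e ≤ 1) (hs : 0 ≤ s) (ht : 0 ≤ t) (hr : 1 < r) (hrP : r ≤ P)
    (hPk : P ≤ (k : ℝ) + 1) :
    K * e ^ k * s ^ (r - 1) * t ≤ α * e ^ (k + 1) * s ^ r + K * max 1 (K / α) ^ P * t ^ r := by
  have hmul : ∀ y : ℝ, 0 ≤ y → y ^ (r - 1) * y = y ^ r := fun y hy => by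
    conv_lhs => rw [← rpow_one y, ← rpow_mul hy, one_mul, ← rpow_add' hy (by linarith)]
    congr 1; ring
  have hm : 1 ≤ max 1 (K / α) := le_max_left _ _
  rcases le_total (K * t) (α * (e * s)) with h | h
  · have h1 : K * e ^ k * s ^ (r - 1) * t ≤ α * e ^ (k + 1) * s ^ r := by
      calc K * e ^ k * s ^ (r - 1) * t = (e ^ k * s ^ (r - 1)) * (K * t) := by ring
        _ ≤ (e ^ k * s ^ (r - 1)) * (α * (e * s)) := by gcongr
        _ = α * e ^ (k + 1) * (s ^ (r - 1) * s) := by ring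
        _ = _ := by rw [hmul s hs]
    have : 0 ≤ K * max 1 (K / α) ^ P * t ^ r := by positivity
    linarith
  · have h1 : e * s ≤ max 1 (K / α) * t := by
      have : e * s ≤ K / α * t := by
        rw [div_mul_eq_mul_div, le_div_iff₀ hα]; linarith
      exact this.trans (by gcongr; exact le_max_right _ _)
    have h2 : e ^ k ≤ e ^ (r - 1) := by
      rcases he0.eq_or_lt with rfl | he
      · rw [zero_pow (fun h => by subst h; norm_num at hPk; linarith),
          zero_rpow (by linarith)]
      · rw [← rpow_natCast]
        exact rpow_le_rpow_of_exponent_ge he he1 (by linarith)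
    have h3 : K * e ^ k * s ^ (r - 1) * t ≤ K * max 1 (K / α) ^ P * t ^ r := by
      calc K * e ^ k * s ^ (r - 1) * t ≤ K * e ^ (r - 1) * s ^ (r - 1) * t := by gcongr
        _ = K * (e * s) ^ (r - 1) * t := by rw [mul_rpow he0 hs]; ring
        _ ≤ K * (max 1 (K / α) * t) ^ (r - 1) * t := by
          gcongr
        _ = K * max 1 (K / α) ^ (r - 1) * (t ^ (r - 1) * t) := by
          rw [mul_rpow (by positivity) ht]; ring
        _ ≤ K * max 1 (K / α) ^ P * t ^ r := by
          rw [hmul t ht]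
          have hrP' : r - 1 ≤ P := by linarith
          gcongr
    have : 0 ≤ α * e ^ (k + 1) * s ^ r := by positivity
    linarith

/-- Smooth cutoff functions at every scale `R`, with gradient of order `1 / R`. -/
theorem exists_cutoff (n : ℕ) :
    ∃ C : ℝ, 0 < C ∧ ∀ R : ℝ, 0 < R → ∃ η : Euc n → ℝ, ContDiff ℝ ∞ η ∧
      (∀ x, 0 ≤ η x) ∧ (∀ x, η x ≤ 1) ∧ (∀ x ∈ closedBall 0 R, η x = 1) ∧
      tsupport η ⊆ closedBall 0 (2 * R) ∧ ∀ x, ‖gradient η x‖ ≤ C / R := by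
  let b : ContDiffBump (0 : Euc n) := ⟨1, 2, one_pos, one_lt_two⟩
  have hb : ContDiff ℝ 1 b := b.contDiff
  obtain ⟨C, hC⟩ := (b.hasCompactSupport.fderiv ℝ).exists_bound_of_continuous
    (hb.continuous_fderiv one_ne_zero)
  refine ⟨max C 1, by positivity, fun R hR => ⟨fun x => b (R⁻¹ • x), ?_, fun x => b.nonneg,
    fun x => b.le_one, fun x hx => b.one_of_mem_closedBall ?_, ?_, fun x => ?_⟩⟩
  · exact b.contDiff.comp (contDiff_id.const_smul R⁻¹)
  · rw [mem_closedBall_zero_iff] at hx ⊢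
    rw [norm_smul, norm_inv, norm_of_nonneg hR.le, inv_mul_le_iff₀ hR, mul_one]
    exact hx
  · refine closure_minimal (fun x hx => ?_) isClosed_closedBall
    have hx' : R⁻¹ • x ∈ Function.support b := hx
    rw [b.support_eq, mem_ball_zero_iff, norm_smul, norm_inv, norm_of_nonneg hR.le,
      inv_mul_lt_iff₀ hR] at hx'
    rw [mem_closedBall_zero_iff, mul_comm]
    exact hx'.le
  · rw [norm_gradient_eq_norm_fderiv, fderiv_comp_smul, norm_smul, norm_inv,
      norm_of_nonneg hR.le, div_eq_inv_mul]
    gcongr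
    exact (hC _).trans (le_max_left _ _)

/-- Caccioppoli estimate on balls for bounded subsolutions with variable exponent. -/
theorem exists_setIntegral_rpow_le {n : ℕ} {p : Euc n → ℝ} {pm pP : ℝ} (hpm : 1 < pm)
    (hlb : ∀ᵐ x ∂(volume : Measure (Euc n)), pm ≤ p x)
    (hub : ∀ᵐ x ∂(volume : Measure (Euc n)), p x ≤ pP)
    {F : Euc n → Euc n} (hF : LocallyIntegrable F volume) {am bP M : ℝ} (ham : 0 < am)
    (hbP : 0 ≤ bP) {u : Euc n → ℝ} (hu : ContDiff ℝ 1 u) (hbdd : ∀ x, |u x| ≤ M)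
    (hloc : LocallyIntegrable (fun x => ‖gradient u x‖ ^ p x) (volume : Measure (Euc n)))
    (hcoer : ∀ x, am * ‖gradient u x‖ ^ p x ≤ (inner ℝ (F x) (gradient u x) : ℝ))
    (hgrowth : ∀ x, ‖F x‖ ≤ bP * ‖gradient u x‖ ^ (p x - 1))
    (hsub : ∀ φ : Euc n → ℝ, ContDiff ℝ 1 φ → HasCompactSupport φ → (∀ x, 0 ≤ φ x) →
      ∫ x, (inner ℝ (F x) (gradient φ x) : ℝ) ≤ 0) :
    ∃ C R₀ : ℝ, 0 < R₀ ∧ ∀ R, R₀ ≤ R →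
      ∫ x in closedBall 0 R, ‖gradient u x‖ ^ p x ≤ C * R ^ ((n : ℝ) - pm) := by
  obtain ⟨C, hC, hcut⟩ := exists_cutoff n
  have hM : 0 ≤ M := (abs_nonneg _).trans (hbdd 0)
  set k := ⌈pP⌉₊
  have hk : pP ≤ (k : ℝ) + 1 := (Nat.le_ceil pP).trans (by simp [k])
  set K : ℝ := ((k : ℝ) + 1) * (2 * M) * bP
  have hK : 0 ≤ K := by positivity
  set D : ℝ := K * max 1 (K / (am / 2)) ^ pP
  have hD : 0 ≤ D := by positivity
  set V : ℝ := volume.real (ball (0 : Euc n) 1)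
  refine ⟨2 / am * (D * C ^ pm * (2 ^ n * V)), C, hC, fun R hCR => ?_⟩
  have hR : 0 < R := hC.trans_le hCR
  obtain ⟨η, hη, hη0, hη1, hηR, hηsupp, hηgrad⟩ := hcut R hR
  have hη' : ContDiff ℝ 1 η := hη.of_le (by simp)
  have hηc : HasCompactSupport η :=
    (isCompact_closedBall _ _).of_isClosed_subset (isClosed_tsupport η) hηsupp
  set φ : Euc n → ℝ := fun x => (u x + M) * η x ^ (k + 1)
  have hφ : ContDiff ℝ 1 φ := (hu.add contDiff_const).mul (hη'.pow _)
  have hφc : HasCompactSupport φ := by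
    refine hηc.mono fun x hx h0 => hx ?_
    simp [φ, h0]
  have hφ0 : ∀ x, 0 ≤ φ x := fun x =>
    mul_nonneg (by linarith [neg_le_of_abs_le (hbdd x)]) (pow_nonneg (hη0 x) _)
  have hφ' : ∀ x, fderiv ℝ φ x (F x) = η x ^ (k + 1) * fderiv ℝ u x (F x) +
      (u x + M) * ((k + 1) * η x ^ k * fderiv ℝ η x (F x)) := fun x => by
    have h1 : HasFDerivAt (fun x => u x + M) (fderiv ℝ u x) x :=
      ((hu.differentiable one_ne_zero x).hasFDerivAt).add_const M
    have h2 := ((hη'.differentiable one_ne_zero x).hasFDerivAt).pow (k + 1)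
    rw [show fderiv ℝ φ x = _ from (h1.mul h2).fderiv]
    simp
    ring
  set G : Euc n → ℝ := (closedBall 0 R).indicator fun x => am / 2 * ‖gradient u x‖ ^ p x
  set H : Euc n → ℝ := (closedBall 0 (2 * R)).indicator fun _ => D * (C / R) ^ pm
  have hG : Integrable G volume :=
    (integrable_indicator_iff measurableSet_closedBall).2
      ((hloc.integrableOn_isCompact (isCompact_closedBall _ _)).const_mul _)
  have hH : Integrable H volume :=
    (integrable_indicator_iff measurableSet_closedBall).2
      (integrableOn_const measure_closedBall_lt_top.ne)
  have hpoint : ∀ᵐ x ∂(volume : Measure (Euc n)),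
      G x - H x ≤ (inner ℝ (F x) (gradient φ x) : ℝ) := by
    filter_upwards [hlb, hub] with x hx1 hx2
    have hpx : 1 < p x := hpm.trans_le hx1
    set s := ‖gradient u x‖
    set t := ‖gradient η x‖
    have hs : 0 ≤ s := norm_nonneg _
    have ht : 0 ≤ t := norm_nonneg _
    have hsp : 0 ≤ s ^ p x := rpow_nonneg hs _
    have hyoung : K * η x ^ k * s ^ (p x - 1) * t ≤
        am / 2 * η x ^ (k + 1) * s ^ p x + D * t ^ p x :=
      mul_rpow_sub_one_mul_le (half_pos ham) hK (hη0 x) (hη1 x) hs ht hpx hx2 hk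
    have hGx : G x ≤ am / 2 * η x ^ (k + 1) * s ^ p x := by
      by_cases hx : x ∈ closedBall 0 R
      · simp [G, Set.indicator_of_mem hx, hηR x hx, s]
      · simp only [G, Set.indicator_of_notMem hx]
        have := hη0 x
        positivity
    have hHx : D * t ^ p x ≤ H x := by
      by_cases hx : x ∈ closedBall 0 (2 * R)
      · simp only [H, Set.indicator_of_mem hx]
        have hCR1 : C / R ≤ 1 := (div_le_one hR).2 hCR
        refine mul_le_mul_of_nonneg_left ?_ hD
        exact (rpow_le_rpow ht (hηgrad x) (by linarith)).trans
          (rpow_le_rpow_of_exponent_ge (by positivity) hCR1 hx1)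
      · have ht0 : t = 0 := by
          simp [t, gradient_eq_zero_of_notMem_tsupport fun h => hx (hηsupp h)]
        simp only [H, Set.indicator_of_notMem hx, ht0]
        rw [zero_rpow (by linarith), mul_zero]
    have hu1 : am * s ^ p x ≤ fderiv ℝ u x (F x) := by
      rw [← inner_gradient_eq_fderiv]; exact hcoer x
    have hη2 : |fderiv ℝ η x (F x)| ≤ bP * s ^ (p x - 1) * t := by
      rw [← inner_gradient_eq_fderiv]
      exact (abs_real_inner_le_norm _ _).trans
        (mul_le_mul_of_nonneg_right (hgrowth x) ht)
    have hcross : -(K * η x ^ k * s ^ (p x - 1) * t) ≤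
        (u x + M) * ((k + 1) * η x ^ k * fderiv ℝ η x (F x)) := by
      refine neg_le_of_abs_le ?_
      have hηk : 0 ≤ η x ^ k := pow_nonneg (hη0 x) _
      have huM : |u x + M| ≤ 2 * M :=
        abs_le.2 ⟨by linarith [neg_le_of_abs_le (hbdd x)], by linarith [le_of_abs_le (hbdd x)]⟩
      have hk1 : |(k : ℝ) + 1| = k + 1 := abs_of_nonneg (by positivity)
      rw [abs_mul, abs_mul, abs_mul, abs_of_nonneg hηk, hk1]
      calc |u x + M| * ((k + 1) * η x ^ k * |fderiv ℝ η x (F x)|)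
          ≤ 2 * M * ((k + 1) * η x ^ k * (bP * s ^ (p x - 1) * t)) := by gcongr
        _ = K * η x ^ k * s ^ (p x - 1) * t := by simp only [K]; ring
    have hmain : η x ^ (k + 1) * (am * s ^ p x) ≤ η x ^ (k + 1) * fderiv ℝ u x (F x) :=
      mul_le_mul_of_nonneg_left hu1 (pow_nonneg (hη0 x) _)
    rw [inner_gradient_eq_fderiv, hφ']
    linarith
  have hint := integral_mono_ae (hG.sub hH) (integrable_inner_gradient hF hφ hφc) hpoint
  have hle := hint.trans (hsub φ hφ hφc hφ0)
  simp only [Pi.sub_apply] at hle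
  rw [integral_sub hG hH, integral_indicator measurableSet_closedBall,
    integral_indicator measurableSet_closedBall, integral_const_mul, setIntegral_const,
    Measure.addHaar_real_closedBall _ _ (by positivity), finrank_euclideanSpace_fin,
    smul_eq_mul] at hle
  have hpow : R ^ ((n : ℝ) - pm) = R ^ n / R ^ pm := by
    rw [rpow_sub hR, rpow_natCast]
  rw [div_rpow hC.le hR.le] at hle
  have heq : 2 / am * (D * C ^ pm * (2 ^ n * V)) * R ^ ((n : ℝ) - pm) =
      2 / am * ((2 * R) ^ n * V * (D * (C ^ pm / R ^ pm))) := by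
    rw [hpow, mul_pow]; ring
  rw [heq, div_mul_eq_mul_div, le_div_iff₀ ham]
  linarith

/-- A `C¹` function whose gradient energy on balls decays as the radius grows is constant. -/
theorem exists_eq_const_of_setIntegral_rpow_le {n : ℕ} {p : Euc n → ℝ} {pm : ℝ} (hpm : 0 < pm)
    (hlb : ∀ᵐ x ∂(volume : Measure (Euc n)), pm ≤ p x) (hpn : (n : ℝ) < pm)
    {u : Euc n → ℝ} (hu : ContDiff ℝ 1 u)
    (hloc : LocallyIntegrable (fun x => ‖gradient u x‖ ^ p x) (volume : Measure (Euc n)))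
    {C R₀ : ℝ} (hdecay : ∀ R, R₀ ≤ R →
      ∫ x in closedBall 0 R, ‖gradient u x‖ ^ p x ≤ C * R ^ ((n : ℝ) - pm)) :
    ∃ c : ℝ, ∀ x, u x = c := by
  have hnn : ∀ x, 0 ≤ ‖gradient u x‖ ^ p x := fun x => rpow_nonneg (norm_nonneg _) _
  have hlim : Filter.Tendsto (fun R : ℝ => C * R ^ ((n : ℝ) - pm)) Filter.atTop (nhds 0) := by
    have := (tendsto_rpow_neg_atTop (sub_pos.2 hpn)).const_mul C
    simpa using this
  have hint : ∀ r : ℝ, IntegrableOn (fun x => ‖gradient u x‖ ^ p x) (closedBall 0 r) volume :=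
    fun r => hloc.integrableOn_isCompact (isCompact_closedBall _ _)
  have hzero : ∀ r : ℝ, ∫ x in closedBall 0 r, ‖gradient u x‖ ^ p x = 0 := fun r => by
    refine le_antisymm (ge_of_tendsto hlim ?_) (integral_nonneg hnn)
    filter_upwards [Filter.eventually_ge_atTop r, Filter.eventually_ge_atTop R₀] with R hr hR
    exact (setIntegral_mono_set (hint R) (.of_forall hnn)
      (closedBall_subset_closedBall hr).eventuallyLE).trans (hdecay R hR)
  have hae : ∀ᵐ x ∂(volume : Measure (Euc n)), ‖gradient u x‖ ^ p x = 0 := by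
    have h : ∀ m : ℕ, ∀ᵐ x ∂(volume : Measure (Euc n)),
        x ∈ closedBall (0 : Euc n) m → ‖gradient u x‖ ^ p x = 0 := fun m =>
      (ae_restrict_iff' measurableSet_closedBall).1
        ((setIntegral_eq_zero_iff_of_nonneg_ae (.of_forall hnn) (hint m)).1 (hzero m))
    filter_upwards [ae_all_iff.2 h] with x hx
    exact hx ⌈‖x‖⌉₊ (mem_closedBall_zero_iff.2 (Nat.le_ceil _))
  have hgrad : gradient u = fun _ => 0 := by
    refine (hu.continuous_gradient.ae_eq_iff_eq volume continuous_const).1 ?_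
    filter_upwards [hae, hlb] with x hx hpx
    exact norm_eq_zero.1 (((rpow_eq_zero (norm_nonneg _) (by linarith)).1 hx))
  refine ⟨u 0, fun x => is_const_of_fderiv_eq_zero (𝕜 := ℝ) (hu.differentiable one_ne_zero)
    (fun y => ?_) x 0⟩
  rw [← norm_eq_zero, ← norm_gradient_eq_norm_fderiv, hgrad, norm_zero]

/-- Theorem 4.16 (Riccati-type inequality): let `p⁻ > n` and let `f : [0,∞) → ℝ` be
continuous and satisfy `c(x) s^{q(x)} ≤ f(s) ≤ d(x)(1 + s^{p(x)−1})` for a variable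
exponent `q ≥ 1` and measurable `c, d` with `0 < c₋ ≤ c ≤ c⁺ < d₋ ≤ d ≤ d⁺`.
Then every bounded `u` satisfying `−∫ ⟨𝒜(x,u,∇u), ∇φ⟩ ≥ ∫ f(|∇u|) φ` for all
nonnegative test functions `φ` is constant. -/
theorem liouville_riccati {n : ℕ} (p : Euc n → ℝ) (pm pP : ℝ)
    (hp : IsVarExp p pm pP) (hpn : (n : ℝ) < pm)
    (𝒜 : Euc n → ℝ → Euc n → Euc n) (am bP : ℝ)
    (h𝒜 : IsNSGrowth p 𝒜 am bP)
    (f : ℝ → ℝ) (hfc : ContinuousOn f (Set.Ici 0))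
    (q : Euc n → ℝ) (hqmeas : Measurable q) (hq1 : ∀ x, 1 ≤ q x)
    (c d : Euc n → ℝ) (hcmeas : Measurable c) (hdmeas : Measurable d)
    (cm cP dm dP : ℝ) (hcm : 0 < cm) (hcd : cP < dm)
    (hc : ∀ x, cm ≤ c x ∧ c x ≤ cP) (hd : ∀ x, dm ≤ d x ∧ d x ≤ dP)
    (hsandwich : ∀ (x : Euc n) (s : ℝ), 0 ≤ s →
      c x * s ^ q x ≤ f s ∧ f s ≤ d x * (1 + s ^ (p x - 1)))
    (u : Euc n → ℝ) (hu : ContDiff ℝ 1 u)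
    (hloc : LocallyIntegrable (fun x => ‖gradient u x‖ ^ p x) (volume : Measure (Euc n)))
    (M : ℝ) (hbdd : ∀ x, |u x| ≤ M)
    (hric : ∀ φ : Euc n → ℝ, ContDiff ℝ ∞ φ → HasCompactSupport φ → (∀ x, 0 ≤ φ x) →
      ∫ x, f ‖gradient u x‖ * φ x
        ≤ - ∫ x, (inner ℝ (𝒜 x (u x) (gradient u x)) (gradient φ x) : ℝ)) :
    ∃ C : ℝ, ∀ x, u x = C := by
  obtain ⟨a, b, -, -, hab, hcoer, hgrowth⟩ := h𝒜.growth
  have hpm0 : 0 < pm := one_pos.trans hp.one_lt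
  have hbP : 0 ≤ bP := h𝒜.am_pos.le.trans (by linarith [hab 0])
  set F : Euc n → Euc n := fun x => 𝒜 x (u x) (gradient u x)
  have hcoer' : ∀ x, am * ‖gradient u x‖ ^ p x ≤ (inner ℝ (F x) (gradient u x) : ℝ) := fun x =>
    (mul_le_mul_of_nonneg_right (hab x).1 (rpow_nonneg (norm_nonneg _) _)).trans (hcoer x _ _)
  have hgrowth' : ∀ x, ‖F x‖ ≤ bP * ‖gradient u x‖ ^ (p x - 1) := fun x =>
    (hgrowth x _ _).trans
      (mul_le_mul_of_nonneg_right (hab x).2.2 (rpow_nonneg (norm_nonneg _) _))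
  have hFmeas : Measurable F := by
    have h : Measurable (Function.uncurry fun (tξ : ℝ × Euc n) x => 𝒜 x tξ.1 tξ.2) :=
      measurable_uncurry_of_continuous_of_measurable h𝒜.cont fun tξ => h𝒜.meas tξ.1 tξ.2
    exact h.comp (((hu.continuous.prodMk hu.continuous_gradient).measurable).prodMk
      measurable_id)
  have hFloc : LocallyIntegrable F volume := by
    have hdom : LocallyIntegrable (fun x => bP * (1 + ‖gradient u x‖ ^ p x))
        (volume : Measure (Euc n)) := ((locallyIntegrable_const 1).add hloc).smul bP
    refine hdom.mono hFmeas.aestronglyMeasurable ?_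
    filter_upwards [hp.ae_lb] with x hx
    refine ((hgrowth' x).trans ?_).trans (le_abs_self _)
    refine mul_le_mul_of_nonneg_left ?_ hbP
    have hs := norm_nonneg (gradient u x)
    have hpx : 1 < p x := hp.one_lt.trans_le hx
    rcases le_total ‖gradient u x‖ 1 with h | h
    · exact (rpow_le_one hs h (by linarith)).trans (by linarith [rpow_nonneg hs (p x)])
    · exact (rpow_le_rpow_of_exponent_le h (sub_le_self _ zero_le_one)).trans (by linarith)
  have hsub : ∀ φ : Euc n → ℝ, ContDiff ℝ ∞ φ → HasCompactSupport φ → (∀ x, 0 ≤ φ x) →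
      ∫ x, (inner ℝ (F x) (gradient φ x) : ℝ) ≤ 0 := fun φ h1 h2 h3 => by
    have h4 : 0 ≤ ∫ x, f ‖gradient u x‖ * φ x := integral_nonneg fun x =>
      mul_nonneg ((mul_nonneg (hcm.le.trans (hc x).1) (rpow_nonneg (norm_nonneg _) _)).trans
        (hsandwich x _ (norm_nonneg _)).1) (h3 x)
    linarith [hric φ h1 h2 h3]
  obtain ⟨C, R₀, -, hdecay⟩ := exists_setIntegral_rpow_le hp.one_lt hp.ae_lb hp.ae_ub hFloc
    h𝒜.am_pos hbP hu hbdd hloc hcoer' hgrowth' fun φ h1 h2 h3 =>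
      integral_inner_gradient_nonpos_of_contDiff_one hFloc hsub h1 h2 h3
  exact exists_eq_const_of_setIntegral_rpow_le hpm0 hp.ae_lb hpn hu hloc hdecay

end
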